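/- arXiv:math/0102189 — 2 statements merged into one kernel-verified Lean document; each statement's English description precedes it below -/
import Mathlib

section
/- The Hilbert–Bernays propositional calculus is complete: every tautology is derivable. -/
/-- Formulas of the Hilbert–Bernays propositional calculus. -/
inductive PropForm where
  | var : ℕ → PropForm
  | neg : PropForm → PropForm
  | conj : PropForm → PropForm → PropForm
  | disj : PropForm → PropForm → PropForm
  | imp : PropForm → PropForm → PropForm

/-- Evaluation of a formula under a valuation of the propositional variables. -/
def PropForm.eval (v : ℕ → Bool) : PropForm → Bool
  | .var n => v n
  | .neg A => !(A.eval v)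
  | .conj A B => A.eval v && B.eval v
  | .disj A B => A.eval v || B.eval v
  | .imp A B => !(A.eval v) || B.eval v

/-- A formula is a tautology (correct) if it is true under every valuation. -/
def PropForm.Tautology (A : PropForm) : Prop := ∀ v : ℕ → Bool, A.eval v = true

/-- Derivability in the Hilbert–Bernays propositional calculus: all instances of the
twelve axiom schemas, closed under modus ponens. -/
inductive HBDeriv : PropForm → Prop where
  | ax1 (A B : PropForm) : HBDeriv (A.imp (B.imp A))
  | ax2 (A B : PropForm) : HBDeriv ((A.imp (A.imp B)).imp (A.imp B))
  | ax3 (A B C : PropForm) : HBDeriv ((A.imp (B.imp C)).imp (B.imp (A.imp C)))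
  | ax4 (A B C : PropForm) : HBDeriv ((B.imp C).imp ((A.imp B).imp (A.imp C)))
  | ax5 (A B : PropForm) : HBDeriv ((A.conj B).imp A)
  | ax6 (A B : PropForm) : HBDeriv ((A.conj B).imp B)
  | ax7 (A B : PropForm) : HBDeriv (A.imp (B.imp (A.conj B)))
  | ax8 (A B : PropForm) : HBDeriv (A.imp (A.disj B))
  | ax9 (A B : PropForm) : HBDeriv (B.imp (A.disj B))
  | ax10 (A B C : PropForm) : HBDeriv ((A.imp C).imp ((B.imp C).imp ((A.disj B).imp C)))
  | ax11 (A B : PropForm) : HBDeriv (A.imp (A.neg.imp B))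
  | ax12 (A B : PropForm) : HBDeriv ((A.imp B).imp ((A.neg.imp B).imp B))
  | mp (A B : PropForm) : HBDeriv A → HBDeriv (A.imp B) → HBDeriv B


/-- Derivability from a set of hypotheses. -/
inductive HBDerivFrom (Γ : Set PropForm) : PropForm → Prop where
  | hyp {A : PropForm} : A ∈ Γ → HBDerivFrom Γ A
  | thm {A : PropForm} : HBDeriv A → HBDerivFrom Γ A
  | mp {A B : PropForm} : HBDerivFrom Γ (A.imp B) → HBDerivFrom Γ A → HBDerivFrom Γ B

namespace HBDerivFrom

variable {Γ Δ : Set PropForm} {A B C : PropForm}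

theorem mono (h : HBDerivFrom Γ A) (hΓ : Γ ⊆ Δ) : HBDerivFrom Δ A := by
  induction h with
  | hyp h => exact hyp (hΓ h)
  | thm h => exact thm h
  | mp _ _ h₁ h₂ => exact mp h₁ h₂

theorem weaken (h : HBDerivFrom Γ A) : HBDerivFrom (insert B Γ) A :=
  h.mono (Set.subset_insert B Γ)

theorem head : HBDerivFrom (insert A Γ) A :=
  hyp (Set.mem_insert A Γ)

theorem hbDeriv (h : HBDerivFrom ∅ A) : HBDeriv A := by
  induction h with
  | hyp h => exact h.elim
  | thm h => exact h
  | mp _ _ h₁ h₂ => exact .mp _ _ h₂ h₁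

/-- The deduction theorem. -/
theorem deduction (h : HBDerivFrom (insert A Γ) B) : HBDerivFrom Γ (A.imp B) := by
  induction h with
  | hyp h =>
    rcases h with rfl | h
    · exact mp (thm (.ax2 _ _)) (thm (.ax1 _ _))
    · exact mp (thm (.ax1 _ _)) (hyp h)
  | thm h => exact mp (thm (.ax1 _ _)) (thm h)
  | mp _ _ h₁ h₂ =>
    exact mp (thm (.ax2 _ _)) (mp (mp (thm (.ax4 _ _ _)) (mp (thm (.ax3 _ _ _)) h₁)) h₂)

theorem absurd (h : HBDerivFrom Γ A) (h' : HBDerivFrom Γ A.neg) : HBDerivFrom Γ B :=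
  mp (mp (thm (.ax11 _ _)) h) h'

theorem by_cases (h : HBDerivFrom (insert A Γ) B) (h' : HBDerivFrom (insert A.neg Γ) B) :
    HBDerivFrom Γ B :=
  mp (mp (thm (.ax12 _ _)) h.deduction) h'.deduction

theorem neg_intro (h : HBDerivFrom (insert A Γ) B) (h' : HBDerivFrom (insert A Γ) B.neg) :
    HBDerivFrom Γ A.neg :=
  by_cases (h.absurd h') head

theorem disj_elim (h : HBDerivFrom Γ (A.disj B)) (hA : HBDerivFrom (insert A Γ) C)
    (hB : HBDerivFrom (insert B Γ) C) : HBDerivFrom Γ C :=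
  mp (mp (mp (thm (.ax10 _ _ _)) hA.deduction) hB.deduction) h

end HBDerivFrom

namespace PropForm

/-- The set of propositional variables occurring in a formula. -/
def vars : PropForm → Finset ℕ
  | .var n => {n}
  | .neg A => A.vars
  | .conj A B => A.vars ∪ B.vars
  | .disj A B => A.vars ∪ B.vars
  | .imp A B => A.vars ∪ B.vars

/-- Whichever of the formula and its negation is true under the valuation. -/
def signed (v : ℕ → Bool) (A : PropForm) : PropForm :=
  if A.eval v then A else A.neg

/-- The literals over the variables in `s` that are true under the valuation `v`. -/
def literals (v : ℕ → Bool) (s : Finset ℕ) : Set PropForm :=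
  (fun n => signed v (.var n)) '' s

theorem literals_update_insert (v : ℕ → Bool) {n : ℕ} {s : Finset ℕ} (hn : n ∉ s) (b : Bool) :
    literals (Function.update v n b) (insert n s) =
      insert (if b then .var n else (PropForm.var n).neg) (literals v s) := by
  have hs : literals (Function.update v n b) s = literals v s := by
    refine Set.image_congr fun m hm => ?_
    have hmn : m ≠ n := fun h => hn (h ▸ hm)
    have hv : eval (Function.update v n b) (.var m) = eval v (.var m) := by
      simp only [eval, Function.update_of_ne hmn]
    simp only [signed, hv]
  rw [← hs]
  simp [literals, Set.image_insert_eq, signed, eval]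

/-- The Kalmár lemma: the literals true under a valuation decide every formula in their
variables according to its truth value. -/
theorem hbDerivFrom_signed (v : ℕ → Bool) {s : Finset ℕ} (A : PropForm) (hA : A.vars ⊆ s) :
    HBDerivFrom (literals v s) (A.signed v) := by
  induction A with
  | var n => exact .hyp ⟨n, by simpa [vars] using hA, rfl⟩
  | neg A ih =>
    have ih := ih hA
    cases h : A.eval v <;> simp only [signed, eval, h] at ih ⊢
    · exact ih
    · exact .neg_intro ih.weaken .head
  | conj A B ihA ihB =>
    have ihA := ihA (Finset.union_subset_left hA)
    have ihB := ihB (Finset.union_subset_right hA)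
    cases hA : A.eval v
    · simp only [signed, eval, hA] at ihA ⊢
      exact .neg_intro (.mp (.thm (.ax5 _ _)) .head) ihA.weaken
    · cases hB : B.eval v <;> simp only [signed, eval, hA, hB] at ihA ihB ⊢
      · exact .neg_intro (.mp (.thm (.ax6 _ _)) .head) ihB.weaken
      · exact .mp (.mp (.thm (.ax7 _ _)) ihA) ihB
  | disj A B ihA ihB =>
    have ihA := ihA (Finset.union_subset_left hA)
    have ihB := ihB (Finset.union_subset_right hA)
    cases hA : A.eval v <;> cases hB : B.eval v <;>
      simp only [signed, eval, hA, hB] at ihA ihB ⊢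
    · exact .neg_intro (.disj_elim .head .head (.absurd .head ihB.weaken.weaken)) ihA.weaken
    · exact .mp (.thm (.ax9 _ _)) ihB
    · exact .mp (.thm (.ax8 _ _)) ihA
    · exact .mp (.thm (.ax8 _ _)) ihA
  | imp A B ihA ihB =>
    have ihA := ihA (Finset.union_subset_left hA)
    have ihB := ihB (Finset.union_subset_right hA)
    cases hA : A.eval v <;> cases hB : B.eval v <;>
      simp only [signed, eval, hA, hB] at ihA ihB ⊢
    · exact .deduction (.absurd .head ihA.weaken)
    · exact .deduction ihB.weaken
    · exact .neg_intro (.mp .head ihA.weaken) ihB.weaken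
    · exact .deduction ihB.weaken

/-- A formula derivable from the literals of every valuation on a finite set of variables
is derivable. -/
theorem hbDeriv_of_forall_literals {A : PropForm} (s : Finset ℕ)
    (h : ∀ v, HBDerivFrom (literals v s) A) : HBDeriv A := by
  induction s using Finset.induction_on with
  | empty => exact HBDerivFrom.hbDeriv (by simpa [literals] using h fun _ => true)
  | insert n s hn ih =>
    refine ih fun v => HBDerivFrom.by_cases (A := .var n) ?_ ?_
    · simpa [literals_update_insert v hn] using h (Function.update v n true)
    · simpa [literals_update_insert v hn] using h (Function.update v n false)

end PropForm

/-- Completeness of the Hilbert–Bernays propositional calculus: every tautology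
is derivable. -/
theorem hbDeriv_complete (A : PropForm) (h : A.Tautology) : HBDeriv A := by
  refine PropForm.hbDeriv_of_forall_literals A.vars fun v => ?_
  simpa [PropForm.signed, h v] using PropForm.hbDerivFrom_signed v A subset_rfl
end

section
/- In Hilbert's 1920 equational system, the formula a+1 = 1 is not derivable (for any variable or term a). -/
/-- Terms of Hilbert's 1920 equational system: individual variables, the constant 1,
and successor `t+1`. -/
inductive Tm0 where
  | var : ℕ → Tm0
  | one : Tm0
  | succ : Tm0 → Tm0

/-- Formulas of Hilbert's 1920 equational system: equations between terms and
implications between formulas. -/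
inductive Fm0 where
  | eq : Tm0 → Tm0 → Fm0
  | imp : Fm0 → Fm0 → Fm0

/-- Derivability in Hilbert's 1920 equational system: all substitution instances
(arbitrary terms replacing the variables) of the four axioms `1 = 1`,
`(a = b) → (a+1 = b+1)`, `(a+1 = b+1) → (a = b)`, and
`(a = b) → ((a = c) → (b = c))`, closed under modus ponens. -/
inductive Deriv0 : Fm0 → Prop where
  | ax1 : Deriv0 (.eq .one .one)
  | ax2 (a b : Tm0) : Deriv0 ((Fm0.eq a b).imp (.eq a.succ b.succ))
  | ax3 (a b : Tm0) : Deriv0 ((Fm0.eq a.succ b.succ).imp (.eq a b))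
  | ax4 (a b c : Tm0) : Deriv0 ((Fm0.eq a b).imp ((Fm0.eq a c).imp (.eq b c)))
  | mp (A B : Fm0) : Deriv0 A → Deriv0 (A.imp B) → Deriv0 B

/-- Truth in the term model, where an equation holds iff its two sides are the same term. -/
def Fm0.TermTrue : Fm0 → Prop
  | .eq s t => s = t
  | .imp A B => A.TermTrue → B.TermTrue

theorem Deriv0.termTrue {A : Fm0} (h : Deriv0 A) : A.TermTrue := by
  induction h with
  | ax1 => rfl
  | ax2 a b => exact congrArg Tm0.succ
  | ax3 a b => exact Tm0.succ.inj
  | ax4 a b c => exact fun hab hac => Eq.trans (Eq.symm hab) hac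
  | mp A B _ _ hA hAB => exact hAB hA

/-- In Hilbert's 1920 equational system, the formula `a+1 = 1` is not derivable,
for any term `a`. -/
theorem not_deriv_succ_eq_one (a : Tm0) : ¬ Deriv0 (Fm0.eq a.succ .one) := by
  intro h
  exact Tm0.noConfusion h.termTrue
end
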